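/- arXiv:1202.5123 — 4 statements merged into one kernel-verified Lean document; each statement's English description precedes it below -/
import Mathlib

section
/- Let μ be a Borel probability measure on X satisfying the twisted invariance relation with parameters (a, β). Let ρ₀ ∈ X be a periodic point of the flow, i.e. φ_{T₀}(ρ₀) = ρ₀ for some period T₀ > 0, and let γ = {φ_s(ρ₀) : s ∈ ℝ} be its (compact) orbit. If the Birkhoff average of −a along γ differs from β, i.e. (1/T₀)·(−∫₀^{T₀} a(φ_s(ρ₀)) ds) ≠ β, then μ(γ) = 0. -/
open MeasureTheory Filter

/-- The twisted invariance relation satisfied by semiclassical measures of eigenmodes of the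
damped wave equation. -/
def TwistedInvariant {X : Type*} [TopologicalSpace X] [MeasurableSpace X]
    (φ : Flow ℝ X) (a : X → ℝ) (β : ℝ) (μ : Measure X) : Prop :=
  ∀ (b : C(X, ℝ)) (t : ℝ),
    ∫ x, b x ∂μ =
      ∫ ρ, b (φ t ρ) * Real.exp (-2 * β * t - 2 * ∫ s in (0:ℝ)..t, a (φ s ρ)) ∂μ

/-- The density of the pulled-back measure in the twisted invariance relation is continuous. -/
lemma Flow.continuous_exp_intervalIntegral {X : Type*} [TopologicalSpace X]
    (φ : Flow ℝ X) {a : X → ℝ} (ha : Continuous a) (β t : ℝ) :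
    Continuous fun ρ => Real.exp (-2 * β * t - 2 * ∫ s in (0:ℝ)..t, a (φ s ρ)) := by
  have h : Continuous fun ρ => ∫ s in (0:ℝ)..t, a (φ s ρ) :=
    intervalIntegral.continuous_parametric_intervalIntegral_of_continuous'
      (f := fun ρ s => a (φ s ρ)) (ha.comp (φ.continuous continuous_snd continuous_fst)) 0 t
  fun_prop

/-- The integral of an observable over a period does not depend on the point of the orbit. -/
lemma Flow.intervalIntegral_eq_of_periodic {X : Type*} [TopologicalSpace X]
    (φ : Flow ℝ X) (a : X → ℝ) {x : X} {T : ℝ} (hper : φ T x = x) (u : ℝ) :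
    ∫ s in (0:ℝ)..T, a (φ s (φ u x)) = ∫ s in (0:ℝ)..T, a (φ s x) := by
  have hp : Function.Periodic (fun s => a (φ s x)) T := fun s => by
    simp only [φ.map_add, hper]
  simp_rw [← φ.map_add]
  rw [intervalIntegral.integral_comp_add_right (fun s => a (φ s x)) u, add_comm T u]
  simpa using hp.intervalIntegral_add_eq (0 + u) 0

/-- The orbit of a periodic point is compact. -/
lemma Flow.isCompact_range_of_periodic {X : Type*} [TopologicalSpace X]
    (φ : Flow ℝ X) {x : X} {T : ℝ} (hT : 0 < T) (hper : φ T x = x) :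
    IsCompact (Set.range fun s : ℝ => φ s x) := by
  have hp : Function.Periodic (fun s => φ s x) T := fun s => by
    simp only [φ.map_add, hper]
  have hc : Continuous fun s : ℝ => φ s x := φ.continuous continuous_id continuous_const
  rw [← hp.image_Icc hT 0]
  exact isCompact_Icc.image hc

/-- The twisted invariance relation as an equality of measures. -/
lemma TwistedInvariant.map_withDensity_eq {X : Type*} [MetricSpace X] [CompactSpace X]
    [MeasurableSpace X] [BorelSpace X] {φ : Flow ℝ X} {a : X → ℝ} (ha : Continuous a) {β : ℝ}
    {μ : Measure X} [IsFiniteMeasure μ] (hμ : TwistedInvariant φ a β μ) (t : ℝ) :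
    (μ.withDensity fun ρ => ENNReal.ofReal
      (Real.exp (-2 * β * t - 2 * ∫ s in (0:ℝ)..t, a (φ s ρ)))).map (φ t) = μ := by
  have hg := φ.continuous_exp_intervalIntegral ha β t
  have hφ : Continuous (φ t) := φ.continuous continuous_const continuous_id
  have hfin : IsFiniteMeasure (μ.withDensity fun ρ => ENNReal.ofReal
      (Real.exp (-2 * β * t - 2 * ∫ s in (0:ℝ)..t, a (φ s ρ)))) :=
    isFiniteMeasure_withDensity_ofReal
      (hg.integrable_of_hasCompactSupport (HasCompactSupport.of_compactSpace _)).2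
  refine ext_of_forall_integral_eq_of_IsFiniteMeasure fun b => ?_
  rw [integral_map hφ.aemeasurable b.continuous.aestronglyMeasurable,
    integral_withDensity_eq_integral_toReal_smul hg.measurable.ennreal_ofReal (by simp)]
  refine Eq.trans ?_ (hμ b.toContinuousMap t).symm
  refine integral_congr_ae (Eventually.of_forall fun ρ => ?_)
  simp [ENNReal.toReal_ofReal (Real.exp_pos _).le, mul_comm]

theorem measure_zero_of_periodic_orbit_birkhoff_ne
    {X : Type*} [MetricSpace X] [CompactSpace X] [MeasurableSpace X] [BorelSpace X]
    (φ : Flow ℝ X) (a : X → ℝ) (ha : Continuous a) (β : ℝ)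
    (μ : Measure X) [IsProbabilityMeasure μ]
    (hμ : TwistedInvariant φ a β μ)
    (ρ₀ : X) (T₀ : ℝ) (hT₀ : 0 < T₀) (hper : φ T₀ ρ₀ = ρ₀)
    (hBirkhoff : (1 / T₀) * (-(∫ s in (0:ℝ)..T₀, a (φ s ρ₀))) ≠ β) :
    μ (Set.range fun s : ℝ => φ s ρ₀) = 0 := by
  set γ := Set.range fun s : ℝ => φ s ρ₀ with hγ
  have hγm : MeasurableSet γ := (φ.isCompact_range_of_periodic hT₀ hper).measurableSet
  have hφ : Continuous (φ T₀) := φ.continuous continuous_const continuous_id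
  have hpre : φ T₀ ⁻¹' γ = γ := by
    ext x
    constructor
    · rintro ⟨s, hs⟩
      refine ⟨-T₀ + s, ?_⟩
      simp only at hs ⊢
      rw [φ.map_add, hs, ← φ.map_add, neg_add_cancel, φ.map_zero_apply]
    · rintro ⟨s, rfl⟩
      exact ⟨T₀ + s, φ.map_add _ _ _⟩
  set I := ∫ s in (0:ℝ)..T₀, a (φ s ρ₀) with hI
  have key : μ γ = ENNReal.ofReal (Real.exp (-2 * β * T₀ - 2 * I)) * μ γ := by
    conv_lhs => rw [← hμ.map_withDensity_eq ha T₀]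
    rw [Measure.map_apply hφ.measurable hγm, hpre, withDensity_apply _ hγm,
      ← setLIntegral_const]
    refine setLIntegral_congr_fun hγm ?_
    rintro _ ⟨u, rfl⟩
    simp only [φ.intervalIntegral_eq_of_periodic a hper u, hI]
  by_contra h0
  have h1 : ENNReal.ofReal (Real.exp (-2 * β * T₀ - 2 * I)) = 1 :=
    (ENNReal.mul_eq_right h0 (measure_ne_top μ γ)).mp key.symm
  rw [ENNReal.ofReal_eq_one, Real.exp_eq_one_iff] at h1
  apply hBirkhoff
  field_simp
  linarith
end

section
/- Let μ be a Borel probability measure on X satisfying the twisted invariance relation with parameters (a, β). Then for every T > 0 one has inf_{ρ∈X} (−∫₀^T a(φ_s(ρ)) ds) ≤ βT ≤ sup_{ρ∈X} (−∫₀^T a(φ_s(ρ)) ds). In particular, β lies in the interval [A₋, A₊], where A₊ = lim_{T→∞} (1/T) sup_{ρ∈X} (−∫₀^T a(φ_s(ρ)) ds) and A₋ = lim_{T→∞} (1/T) inf_{ρ∈X} (−∫₀^T a(φ_s(ρ)) ds). -/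
open MeasureTheory Filter

/-- The integral of a continuous function along orbit segments of length `T` depends continuously
on the starting point. -/
lemma continuous_integral_flow {X : Type*} [TopologicalSpace X] (φ : Flow ℝ X) {a : X → ℝ}
    (ha : Continuous a) (T : ℝ) : Continuous fun ρ => ∫ s in (0:ℝ)..T, a (φ s ρ) :=
  intervalIntegral.continuous_parametric_intervalIntegral_of_continuous'
    (f := fun ρ s => a (φ s ρ)) (ha.comp (φ.continuous continuous_snd continuous_fst)) 0 T

/-- Under the twisted invariance relation, `-∫₀ᵀ a ∘ φ_s ds` takes values on both sides
of `β * T`. -/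
lemma TwistedInvariant.exists_le_and_exists_ge {X : Type*} [TopologicalSpace X] [CompactSpace X]
    [MeasurableSpace X] [OpensMeasurableSpace X] {φ : Flow ℝ X} {a : X → ℝ} (ha : Continuous a)
    {β : ℝ} {μ : Measure X} [IsProbabilityMeasure μ] (hμ : TwistedInvariant φ a β μ) (T : ℝ) :
    (∃ ρ, -(∫ s in (0:ℝ)..T, a (φ s ρ)) ≤ β * T) ∧
      ∃ ρ, β * T ≤ -(∫ s in (0:ℝ)..T, a (φ s ρ)) := by
  have hcont : Continuous fun ρ =>
      Real.exp (-2 * β * T - 2 * ∫ s in (0:ℝ)..T, a (φ s ρ)) :=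
    Real.continuous_exp.comp
      (continuous_const.sub (continuous_const.mul (continuous_integral_flow φ ha T)))
  have hint := hcont.integrable_of_hasCompactSupport (μ := μ) (HasCompactSupport.of_compactSpace _)
  have hone : 1 = ∫ ρ, Real.exp (-2 * β * T - 2 * ∫ s in (0:ℝ)..T, a (φ s ρ)) ∂μ := by
    simpa using hμ 1 T
  constructor
  · obtain ⟨ρ, hρ⟩ := exists_le_integral hint
    rw [← hone, Real.exp_le_one_iff] at hρ
    exact ⟨ρ, by linarith⟩
  · obtain ⟨ρ, hρ⟩ := exists_integral_le hint
    rw [← hone, Real.one_le_exp_iff] at hρ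
    exact ⟨ρ, by linarith⟩

theorem beta_between_inf_and_sup_of_twisted_invariant
    {X : Type*} [MetricSpace X] [CompactSpace X] [MeasurableSpace X] [BorelSpace X]
    (φ : Flow ℝ X) (a : X → ℝ) (ha : Continuous a) (β : ℝ)
    (μ : Measure X) [IsProbabilityMeasure μ]
    (hμ : TwistedInvariant φ a β μ) :
    (∀ T : ℝ, 0 < T →
      (⨅ ρ : X, -(∫ s in (0:ℝ)..T, a (φ s ρ))) ≤ β * T ∧
      β * T ≤ ⨆ ρ : X, -(∫ s in (0:ℝ)..T, a (φ s ρ))) ∧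
    (∀ Aplus Aminus : ℝ,
      Tendsto (fun T : ℝ => (1 / T) * ⨆ ρ : X, -(∫ s in (0:ℝ)..T, a (φ s ρ)))
        atTop (nhds Aplus) →
      Tendsto (fun T : ℝ => (1 / T) * ⨅ ρ : X, -(∫ s in (0:ℝ)..T, a (φ s ρ)))
        atTop (nhds Aminus) →
      Aminus ≤ β ∧ β ≤ Aplus) := by
  have hbound : ∀ T : ℝ, 0 < T →
      (⨅ ρ : X, -(∫ s in (0:ℝ)..T, a (φ s ρ))) ≤ β * T ∧
      β * T ≤ ⨆ ρ : X, -(∫ s in (0:ℝ)..T, a (φ s ρ)) := by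
    intro T _
    have hrange := isCompact_range (continuous_integral_flow φ ha T).neg
    obtain ⟨⟨ρ, hρ⟩, ⟨σ, hσ⟩⟩ := hμ.exists_le_and_exists_ge ha T
    exact ⟨(ciInf_le hrange.bddBelow ρ).trans hρ, hσ.trans (le_ciSup hrange.bddAbove σ)⟩
  refine ⟨hbound, fun Aplus Aminus hplus hminus => ⟨?_, ?_⟩⟩
  · refine le_of_tendsto hminus ?_
    filter_upwards [eventually_gt_atTop 0] with T hT
    rw [one_div_mul_eq_div, div_le_iff₀ hT]
    exact (hbound T hT).1
  · refine ge_of_tendsto hplus ?_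
    filter_upwards [eventually_gt_atTop 0] with T hT
    rw [one_div_mul_eq_div, le_div_iff₀ hT]
    exact (hbound T hT).2
end

section
/- Let μ be a Borel probability measure on X satisfying the twisted invariance relation with parameters (a, β). Suppose there exist a Borel set Λ ⊆ X with μ(Λ) = 1, a constant C ≥ 0 and β' ∈ ℝ such that for every ρ ∈ Λ and every T > 0 one has β'T − C ≤ −∫₀^T a(φ_s(ρ)) ds ≤ β'T + C. Then β = β'. -/
open MeasureTheory Filter

/-- If the exponential of a function bounded almost everywhere between `l` and `u` has integral `1`
against a probability measure, then `l ≤ 0 ≤ u`. -/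
theorem nonpos_and_nonneg_of_integral_exp_eq_one {X : Type*} [MeasurableSpace X]
    {μ : Measure X} [IsProbabilityMeasure μ] {f : X → ℝ} {l u : ℝ}
    (hf : ∫ x, Real.exp (f x) ∂μ = 1) (hl : ∀ᵐ x ∂μ, l ≤ f x) (hu : ∀ᵐ x ∂μ, f x ≤ u) :
    l ≤ 0 ∧ 0 ≤ u := by
  have hint : Integrable (fun x => Real.exp (f x)) μ :=
    Integrable.of_integral_ne_zero (by rw [hf]; exact one_ne_zero)
  constructor
  · have h : ∫ _, Real.exp l ∂μ ≤ ∫ x, Real.exp (f x) ∂μ :=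
      integral_mono_ae (integrable_const _) hint (hl.mono fun x hx => Real.exp_le_exp.2 hx)
    simpa [hf] using h
  · have h : ∫ x, Real.exp (f x) ∂μ ≤ ∫ _, Real.exp u ∂μ :=
      integral_mono_ae hint (integrable_const _) (hu.mono fun x hx => Real.exp_le_exp.2 hx)
    simpa [hf] using h

/-- A real number all of whose positive multiples stay in a fixed bounded interval is zero. -/
theorem eq_zero_of_forall_pos_abs_mul_le {d C : ℝ} (h : ∀ T : ℝ, 0 < T → |d * T| ≤ C) : d = 0 := by
  by_contra hd
  have hd' : 0 < |d| := abs_pos.2 hd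
  have hC : 0 ≤ C := (abs_nonneg _).trans (h 1 one_pos)
  have hT : 0 < (C + 1) / |d| := by positivity
  have := h _ hT
  rw [abs_mul, abs_of_pos hT, mul_div_cancel₀ _ hd'.ne'] at this
  linarith

theorem damping_parameter_determined_by_two_sided_birkhoff_bound
    {X : Type*} [MetricSpace X] [CompactSpace X] [MeasurableSpace X] [BorelSpace X]
    (φ : Flow ℝ X) (a : X → ℝ) (ha : Continuous a) (β : ℝ)
    (μ : Measure X) [IsProbabilityMeasure μ]
    (hμ : TwistedInvariant φ a β μ)
    (Λ : Set X) (hΛmeas : MeasurableSet Λ) (hΛfull : μ Λ = 1)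
    (C : ℝ) (hC : 0 ≤ C) (β' : ℝ)
    (hbound : ∀ ρ ∈ Λ, ∀ T : ℝ, 0 < T →
      β' * T - C ≤ -(∫ s in (0:ℝ)..T, a (φ s ρ)) ∧
      -(∫ s in (0:ℝ)..T, a (φ s ρ)) ≤ β' * T + C) :
    β = β' := by
  have hae : ∀ᵐ ρ ∂μ, ρ ∈ Λ := (prob_compl_eq_zero_iff hΛmeas).2 hΛfull
  suffices h : ∀ T : ℝ, 0 < T → |(β' - β) * T| ≤ C by
    linarith [eq_zero_of_forall_pos_abs_mul_le h]
  intro T hT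
  have hone : ∫ ρ, Real.exp (-2 * β * T - 2 * ∫ s in (0:ℝ)..T, a (φ s ρ)) ∂μ = 1 := by
    simpa using (hμ 1 T).symm
  obtain ⟨hl, hu⟩ := nonpos_and_nonneg_of_integral_exp_eq_one
    (l := 2 * ((β' - β) * T) - 2 * C) (u := 2 * ((β' - β) * T) + 2 * C) hone
    (hae.mono fun ρ hρ => by linarith [(hbound ρ hρ T hT).1])
    (hae.mono fun ρ hρ => by linarith [(hbound ρ hρ T hT).2])
  exact abs_le.2 ⟨by linarith, by linarith⟩
end

section
/- Let μ be a Borel probability measure on X satisfying the twisted invariance relation with parameters (a, β), and suppose in addition that Λ ⊆ X is a closed set with μ(Λ) = 1 and that there is a constant C ≥ 0 such that for all ρ ∈ Λ and all T > 0, −∫₀^T a(φ_s(ρ)) ds ≤ βT + C. Then for every nonnegative continuous function b : X → ℝ and every t ≥ 0, ∫_X b dμ ≤ e^{2C} ∫_X b(φ_t(ρ)) dμ(ρ). -/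
open MeasureTheory Filter

theorem integral_le_exp_mul_integral_comp_flow_of_one_sided_birkhoff_bound
    {X : Type*} [MetricSpace X] [CompactSpace X] [MeasurableSpace X] [BorelSpace X]
    (φ : Flow ℝ X) (a : X → ℝ) (ha : Continuous a) (β : ℝ)
    (μ : Measure X) [IsProbabilityMeasure μ]
    (hμ : TwistedInvariant φ a β μ)
    (Λ : Set X) (hΛclosed : IsClosed Λ) (hΛfull : μ Λ = 1)
    (C : ℝ) (hC : 0 ≤ C)
    (hbound : ∀ ρ ∈ Λ, ∀ T : ℝ, 0 < T →
      -(∫ s in (0:ℝ)..T, a (φ s ρ)) ≤ β * T + C) :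
    ∀ (b : C(X, ℝ)), (∀ x, 0 ≤ b x) → ∀ t : ℝ, 0 ≤ t →
      (∫ x, b x ∂μ) ≤ Real.exp (2 * C) * ∫ ρ, b (φ t ρ) ∂μ := by
  intro b hb t ht
  have hΛae : ∀ᵐ ρ ∂μ, ρ ∈ Λ := (mem_ae_iff_prob_eq_one hΛclosed.measurableSet).2 hΛfull
  have hcont : Continuous fun ρ => b (φ t ρ) :=
    b.continuous.comp (φ.continuous continuous_const continuous_id)
  have hint : Integrable (fun ρ => b (φ t ρ)) μ :=
    hcont.integrable_of_hasCompactSupport (HasCompactSupport.of_compactSpace _)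
  rw [hμ b t, ← integral_const_mul]
  refine integral_mono_of_nonneg (ae_of_all _ fun ρ => mul_nonneg (hb _) (Real.exp_pos _).le)
    (hint.const_mul _) ?_
  filter_upwards [hΛae] with ρ hρ
  rw [mul_comm]
  refine mul_le_mul_of_nonneg_right (Real.exp_le_exp.2 ?_) (hb _)
  rcases ht.eq_or_lt with rfl | ht
  · simpa using hC
  · linarith [hbound ρ hρ t ht]
end
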